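/- arXiv:0902.4899 — 2 statements merged into one kernel-verified Lean document; each statement's English description precedes it below -/
import Mathlib

section
/- For n ≥ 4 and every m ≥ 2, the lower central series of the free algebra satisfies L_{m+1} = Σ_{i} [x_i, L_m] + Σ_{i ≤ j} [x_i x_j, L_m] + Σ_{i < j < k} [x_i[x_j,x_k], L_m] + L_{m+2}; i.e. B_{m+1} = Σ_i [x_i, B_m] + Σ_{i≤j} [x_i x_j, B_m] + Σ_{i<j<k} [x_i[x_j,x_k], B_m]. -/
/-- The lower central series of the free algebra `A_n = FreeAlgebra ℂ (Fin n)`,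
as a chain of `ℂ`-subspaces: `lcs n 1 = A`, `lcs n (m+1) = span {[a,w] : a ∈ A, w ∈ lcs n m}`.
(The value at `0` is junk, set to `⊤`.) -/
def lcs (n : ℕ) : ℕ → Submodule ℂ (FreeAlgebra ℂ (Fin n))
  | 0 => ⊤
  | 1 => ⊤
  | m + 2 => Submodule.span ℂ
      {y | ∃ a w, w ∈ lcs n (m + 1) ∧ y = a * w - w * a}

/-- For `g ∈ A` and a `ℂ`-subspace `V ⊆ A`, `[g, V] = span {[g,w] : w ∈ V}`. -/
def brS {n : ℕ} (g : FreeAlgebra ℂ (Fin n)) (V : Submodule ℂ (FreeAlgebra ℂ (Fin n))) :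
    Submodule ℂ (FreeAlgebra ℂ (Fin n)) :=
  Submodule.span ℂ {y | ∃ w ∈ V, y = g * w - w * g}

attribute [local instance] LieRing.ofAssociativeRing

lemma lcs_add_two (n k : ℕ) : lcs n (k + 2) = Submodule.span ℂ
    {y | ∃ a w, w ∈ lcs n (k + 1) ∧ y = a * w - w * a} := by
  rw [lcs]

lemma lie_mem_lcs {n k : ℕ} (a : FreeAlgebra ℂ (Fin n)) {w : FreeAlgebra ℂ (Fin n)}
    (hw : w ∈ lcs n (k + 1)) : ⁅a, w⁆ ∈ lcs n (k + 2) := by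
  rw [lcs_add_two]
  exact Submodule.subset_span ⟨a, w, hw, Ring.lie_def a w⟩

lemma lie_mem_lcs_left {n k : ℕ} (a : FreeAlgebra ℂ (Fin n)) {w : FreeAlgebra ℂ (Fin n)}
    (hw : w ∈ lcs n (k + 1)) : ⁅w, a⁆ ∈ lcs n (k + 2) := by
  rw [← lie_skew]
  exact neg_mem (lie_mem_lcs a hw)

lemma mem_lcs_one {n : ℕ} (a : FreeAlgebra ℂ (Fin n)) : a ∈ lcs n 1 := by
  rw [lcs]; trivial

/-- To bound `⁅a, w⁆` for `w ∈ L_{k+2}` it is enough to treat `w = ⁅e, v⁆` with `v ∈ L_{k+1}`. -/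
lemma lie_lcs_induction {n k : ℕ} {a : FreeAlgebra ℂ (Fin n)}
    {S : Submodule ℂ (FreeAlgebra ℂ (Fin n))}
    (h : ∀ e v : FreeAlgebra ℂ (Fin n), v ∈ lcs n (k + 1) → ⁅a, ⁅e, v⁆⁆ ∈ S)
    {w : FreeAlgebra ℂ (Fin n)} (hw : w ∈ lcs n (k + 2)) : ⁅a, w⁆ ∈ S := by
  rw [lcs_add_two] at hw
  induction hw using Submodule.span_induction with
  | mem x hx =>
    obtain ⟨e, v, hv, rfl⟩ := hx
    exact h e v hv
  | zero => simp
  | add x y _ _ hx hy => rw [lie_add]; exact add_mem hx hy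
  | smul c x _ hx => rw [lie_smul]; exact S.smul_mem c hx

lemma lcs_succ_le (n k : ℕ) : lcs n (k + 2) ≤ lcs n (k + 1) := by
  induction k with
  | zero => exact fun a _ => mem_lcs_one a
  | succ k ih =>
    rw [lcs_add_two n (k + 1), Submodule.span_le]
    rintro _ ⟨a, w, hw, rfl⟩
    exact lie_mem_lcs a (ih hw)

/-- `[L_i, L_j] ⊆ L_{i+j}`. -/
lemma lie_lcs_lcs {n : ℕ} (j : ℕ) : ∀ {i : ℕ} {u w : FreeAlgebra ℂ (Fin n)},
    u ∈ lcs n (i + 1) → w ∈ lcs n (j + 1) → ⁅u, w⁆ ∈ lcs n (i + j + 2) := by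
  induction j with
  | zero => exact fun hu _ => lie_mem_lcs_left _ hu
  | succ j ih =>
    intro i u w hu hw
    refine lie_lcs_induction (fun e v hv => ?_) hw
    rw [leibniz_lie]
    refine add_mem ?_ (lie_mem_lcs e (ih hu hv))
    have := ih (lie_mem_lcs_left e hu) hv
    rwa [show i + 1 + j + 2 = i + (j + 1) + 2 by ring] at this

/-- `[M_3, A] ⊆ L_3`, where `M_3 = A L_3`. -/
lemma lie_mul_lcs_three_mem {n : ℕ} (a : FreeAlgebra ℂ (Fin n)) {l : FreeAlgebra ℂ (Fin n)}
    (hl : l ∈ lcs n 3) (b : FreeAlgebra ℂ (Fin n)) : ⁅a * l, b⁆ ∈ lcs n 3 := by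
  rw [← lie_skew, neg_mem_iff]
  rw [lcs_add_two n 1] at hl
  induction hl using Submodule.span_induction with
  | mem x hx =>
    obtain ⟨u, v, hv, rfl⟩ := hx
    have e : ⁅b, a * (u * v - v * u)⁆ = ⁅b, ⁅u, a * v⁆⁆ + ⁅⁅u, a⁆, v * b⁆ + ⁅v, b * ⁅u, a⁆⁆ := by
      simp only [Ring.lie_def]; noncomm_ring
    rw [e]
    exact add_mem (add_mem (lie_mem_lcs b (lie_mem_lcs u (mem_lcs_one _)))
      (lie_mem_lcs_left _ (lie_mem_lcs u (mem_lcs_one a)))) (lie_mem_lcs_left _ hv)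
  | zero => simp
  | add x y _ _ hx hy => rw [mul_add, lie_add]; exact add_mem hx hy
  | smul c x _ hx =>
    rw [mul_smul_comm, lie_smul]
    exact Submodule.smul_mem _ c hx

/-- `[M_3, L_k] ⊆ L_{k+2}`, where `M_3 = A L_3`. -/
lemma lie_mul_lcs_three {n : ℕ} (k : ℕ) (a : FreeAlgebra ℂ (Fin n))
    {l : FreeAlgebra ℂ (Fin n)} (hl : l ∈ lcs n 3) :
    ∀ {w : FreeAlgebra ℂ (Fin n)}, w ∈ lcs n (k + 1) → ⁅a * l, w⁆ ∈ lcs n (k + 3) := by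
  induction k with
  | zero => exact fun _ => lie_mul_lcs_three_mem a hl _
  | succ k ih =>
    refine fun hw => lie_lcs_induction (fun e v hv => ?_) hw
    rw [leibniz_lie]
    refine add_mem ?_ (lie_mem_lcs e (ih hv))
    have := lie_lcs_lcs (i := 2) k (lie_mul_lcs_three_mem a hl e) hv
    rwa [show 2 + k + 2 = k + 1 + 3 by ring] at this

/-- Reduction of the commutator with a symmetrized triple product to commutators with products of
at most two factors, up to terms deep in the lower central series. -/
lemma two_smul_lie_symm_triple {A : Type*} [Ring A] (a b c e w : A) :
    (2 : ℤ) • ⁅a * b * c + a * c * b + b * a * c + b * c * a + c * a * b + c * b * a, ⁅e, w⁆⁆ =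
      (3 : ℤ) • (⁅a * b + b * a, ⁅c * e + e * c, w⁆⁆ + ⁅a * c + c * a, ⁅b * e + e * b, w⁆⁆
        + ⁅b * c + c * b, ⁅a * e + e * a, w⁆⁆)
      - (⁅a, ⁅(b * c + c * b) * e + e * (b * c + c * b) + 4 * (b * e * c + c * e * b), w⁆⁆
        + ⁅b, ⁅(a * c + c * a) * e + e * (a * c + c * a) + 4 * (a * e * c + c * e * a), w⁆⁆
        + ⁅c, ⁅(a * b + b * a) * e + e * (a * b + b * a) + 4 * (a * e * b + b * e * a), w⁆⁆)
      + (2 : ℤ) • (⁅e, ⁅a, ⁅b, ⁅c, w⁆⁆⁆⁆ + ⁅e, ⁅a, ⁅c, ⁅b, w⁆⁆⁆⁆ + ⁅e, ⁅b, ⁅a, ⁅c, w⁆⁆⁆⁆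
        + ⁅e, ⁅b, ⁅c, ⁅a, w⁆⁆⁆⁆ + ⁅e, ⁅c, ⁅a, ⁅b, w⁆⁆⁆⁆ + ⁅e, ⁅c, ⁅b, ⁅a, w⁆⁆⁆⁆)
      + (3 : ℤ) • (⁅⁅a, e⁆, ⁅b, ⁅c, w⁆⁆⁆ + ⁅⁅a, e⁆, ⁅c, ⁅b, w⁆⁆⁆ + ⁅⁅b, e⁆, ⁅a, ⁅c, w⁆⁆⁆
        + ⁅⁅b, e⁆, ⁅c, ⁅a, w⁆⁆⁆ + ⁅⁅c, e⁆, ⁅a, ⁅b, w⁆⁆⁆ + ⁅⁅c, e⁆, ⁅b, ⁅a, w⁆⁆⁆)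
      + (⁅⁅a, ⁅b, e⁆⁆, ⁅c, w⁆⁆ + ⁅⁅a, ⁅c, e⁆⁆, ⁅b, w⁆⁆ + ⁅⁅b, ⁅a, e⁆⁆, ⁅c, w⁆⁆
        + ⁅⁅b, ⁅c, e⁆⁆, ⁅a, w⁆⁆ + ⁅⁅c, ⁅a, e⁆⁆, ⁅b, w⁆⁆ + ⁅⁅c, ⁅b, e⁆⁆, ⁅a, w⁆⁆) := by
  simp only [Ring.lie_def]
  noncomm_ring

/-- The subspace of all `a` with `[a, V] ⊆ S`. -/
def lieTransporter {n : ℕ} (V S : Submodule ℂ (FreeAlgebra ℂ (Fin n))) :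
    Submodule ℂ (FreeAlgebra ℂ (Fin n)) where
  carrier := {a | ∀ w ∈ V, ⁅a, w⁆ ∈ S}
  add_mem' ha hb w hw := by rw [add_lie]; exact add_mem (ha w hw) (hb w hw)
  zero_mem' w _ := by simp
  smul_mem' c a ha w hw := by rw [smul_lie]; exact S.smul_mem c (ha w hw)

lemma mem_of_zsmul_mem {M : Type*} [AddCommGroup M] [Module ℂ M] {S : Submodule ℂ M}
    (z : ℤ) (hz : z ≠ 0) {x : M} (h : z • x ∈ S) : x ∈ S := by
  rw [← Int.cast_smul_eq_zsmul ℂ] at h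
  exact (S.smul_mem_iff (Int.cast_ne_zero.mpr hz)).mp h

section Transporter

variable {n k : ℕ} {S : Submodule ℂ (FreeAlgebra ℂ (Fin n))}

lemma symm_triple_mem_lieTransporter (hS : lcs n (k + 4) ≤ S) {a b c : FreeAlgebra ℂ (Fin n)}
    (ha : a ∈ lieTransporter (lcs n (k + 2)) S) (hb : b ∈ lieTransporter (lcs n (k + 2)) S)
    (hc : c ∈ lieTransporter (lcs n (k + 2)) S)
    (hab : a * b + b * a ∈ lieTransporter (lcs n (k + 2)) S)
    (hac : a * c + c * a ∈ lieTransporter (lcs n (k + 2)) S)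
    (hbc : b * c + c * b ∈ lieTransporter (lcs n (k + 2)) S) :
    a * b * c + a * c * b + b * a * c + b * c * a + c * a * b + c * b * a ∈
      lieTransporter (lcs n (k + 2)) S := by
  refine fun v hv => lie_lcs_induction (fun e w hw => ?_) hv
  refine mem_of_zsmul_mem 2 two_ne_zero ?_
  rw [two_smul_lie_symm_triple]
  have outer : ∀ {p : FreeAlgebra ℂ (Fin n)}, p ∈ lieTransporter (lcs n (k + 2)) S →
      ∀ q : FreeAlgebra ℂ (Fin n), ⁅p, ⁅q, w⁆⁆ ∈ S := fun hp q => hp _ (lie_mem_lcs q hw)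
  have deep : lcs n (k + 5) ≤ S := (lcs_succ_le n (k + 3)).trans hS
  have h₁ : ∀ p q r : FreeAlgebra ℂ (Fin n), ⁅e, ⁅p, ⁅q, ⁅r, w⁆⁆⁆⁆ ∈ S := fun p q r =>
    deep (lie_mem_lcs e (lie_mem_lcs p (lie_mem_lcs q (lie_mem_lcs r hw))))
  have h₂ : ∀ p q r : FreeAlgebra ℂ (Fin n), ⁅⁅p, e⁆, ⁅q, ⁅r, w⁆⁆⁆ ∈ S := fun p q r => by
    refine deep ?_
    have := lie_lcs_lcs (i := 1) (k + 2) (lie_mem_lcs p (mem_lcs_one e))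
      (lie_mem_lcs q (lie_mem_lcs r hw))
    rwa [show 1 + (k + 2) + 2 = k + 5 by ring] at this
  have h₃ : ∀ p q r : FreeAlgebra ℂ (Fin n), ⁅⁅p, ⁅q, e⁆⁆, ⁅r, w⁆⁆ ∈ S := fun p q r => by
    refine deep ?_
    have := lie_lcs_lcs (i := 2) (k + 1) (lie_mem_lcs p (lie_mem_lcs q (mem_lcs_one e)))
      (lie_mem_lcs r hw)
    rwa [show 2 + (k + 1) + 2 = k + 5 by ring] at this
  refine add_mem (add_mem (add_mem (sub_mem (zsmul_mem ?_ _) ?_) (zsmul_mem ?_ _))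
    (zsmul_mem ?_ _)) ?_
  · exact add_mem (add_mem (outer hab _) (outer hac _)) (outer hbc _)
  · exact add_mem (add_mem (outer ha _) (outer hb _)) (outer hc _)
  · repeat' first | exact h₁ _ _ _ | apply add_mem
  · repeat' first | exact h₂ _ _ _ | apply add_mem
  · repeat' first | exact h₃ _ _ _ | apply add_mem

lemma lie_mem_lieTransporter (hS : lcs n (k + 4) ≤ S) (a b : FreeAlgebra ℂ (Fin n)) :
    ⁅a, b⁆ ∈ lieTransporter (lcs n (k + 2)) S := by
  intro w hw
  have := lie_lcs_lcs (i := 1) (k + 1) (lie_mem_lcs a (mem_lcs_one b)) hw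
  rw [show 1 + (k + 1) + 2 = k + 4 by ring] at this
  exact hS this

lemma mul_lie_lie_mem_lieTransporter (hS : lcs n (k + 4) ≤ S) (a b c d : FreeAlgebra ℂ (Fin n)) :
    a * ⁅b, ⁅c, d⁆⁆ ∈ lieTransporter (lcs n (k + 2)) S := fun _ hw =>
  hS (lie_mul_lcs_three (k + 1) a (lie_mem_lcs b (lie_mem_lcs c (mem_lcs_one d))) hw)

/-- A product `x (y u)` lies in the transporter if the symmetrized products of its factors do, up to
the term `x [y, u]`. -/
lemma mul_mul_mem_lieTransporter (hS : lcs n (k + 4) ≤ S) {x y u : FreeAlgebra ℂ (Fin n)}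
    (hT : x * y * u + x * u * y + y * x * u + y * u * x + u * x * y + u * y * x ∈
      lieTransporter (lcs n (k + 2)) S)
    (h : x * ⁅y, u⁆ ∈ lieTransporter (lcs n (k + 2)) S) :
    x * (y * u) ∈ lieTransporter (lcs n (k + 2)) S := by
  have hl := lie_mem_lieTransporter (n := n) hS
  refine mem_of_zsmul_mem 6 (by norm_num) ?_
  have e : (6 : ℤ) • (x * (y * u)) =
      (x * y * u + x * u * y + y * x * u + y * u * x + u * x * y + u * y * x)
      + (3 : ℤ) • (x * ⁅y, u⁆) + ⁅x, y * u⁆ + ⁅x * y, u⁆ + ⁅x, u * y⁆ + ⁅x * u, y⁆ := by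
    simp only [Ring.lie_def]; noncomm_ring
  rw [e]
  exact add_mem (add_mem (add_mem (add_mem (add_mem hT (zsmul_mem h 3)) (hl _ _))
    (hl _ _)) (hl _ _)) (hl _ _)

end Transporter

/-- The span of `1` and the generators of the free algebra. -/
def degreeLeOne (n : ℕ) : Submodule ℂ (FreeAlgebra ℂ (Fin n)) :=
  Submodule.span ℂ (insert 1 (Set.range (FreeAlgebra.ι ℂ)))

lemma degreeLeOne_pow_mono (n : ℕ) : Monotone (fun d => degreeLeOne n ^ d) :=
  pow_right_mono₀ (Submodule.one_le.mpr (Submodule.subset_span (Set.mem_insert _ _)))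

lemma mul_mem_degreeLeOne_pow {n i j N : ℕ} (h : i + j ≤ N) {a b : FreeAlgebra ℂ (Fin n)}
    (ha : a ∈ degreeLeOne n ^ i) (hb : b ∈ degreeLeOne n ^ j) : a * b ∈ degreeLeOne n ^ N := by
  refine degreeLeOne_pow_mono n h ?_
  simp only [pow_add]
  exact Submodule.mul_mem_mul ha hb

lemma lie_mem_degreeLeOne_pow {n i j N : ℕ} (h : i + j ≤ N) {a b : FreeAlgebra ℂ (Fin n)}
    (ha : a ∈ degreeLeOne n ^ i) (hb : b ∈ degreeLeOne n ^ j) : ⁅a, b⁆ ∈ degreeLeOne n ^ N :=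
  sub_mem (mul_mem_degreeLeOne_pow h ha hb) (mul_mem_degreeLeOne_pow (by omega) hb ha)

lemma exists_mem_degreeLeOne_pow {n : ℕ} (a : FreeAlgebra ℂ (Fin n)) :
    ∃ d, a ∈ degreeLeOne n ^ d := by
  induction a using FreeAlgebra.induction with
  | grade0 r => exact ⟨0, by rw [pow_zero]; exact Submodule.algebraMap_mem r⟩
  | grade1 x =>
    exact ⟨1, by rw [pow_one]; exact Submodule.subset_span (Set.mem_insert_of_mem _ ⟨x, rfl⟩)⟩
  | mul a b ha hb =>
    obtain ⟨d, hd⟩ := ha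
    obtain ⟨e, he⟩ := hb
    exact ⟨d + e, mul_mem_degreeLeOne_pow le_rfl hd he⟩
  | add a b ha hb =>
    obtain ⟨d, hd⟩ := ha
    obtain ⟨e, he⟩ := hb
    exact ⟨max d e, add_mem (degreeLeOne_pow_mono n (le_max_left d e) hd)
      (degreeLeOne_pow_mono n (le_max_right d e) he)⟩

lemma mul_mem_of_mem_mul {A : Type*} [Semiring A] [Algebra ℂ A] {P Q R : Submodule ℂ A} {x : A}
    (h : ∀ y ∈ P, ∀ z ∈ Q, x * (y * z) ∈ R) {t : A} (ht : t ∈ P * Q) : x * t ∈ R :=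
  Submodule.mul_induction_on ht h fun _ _ ha hb => by rw [mul_add]; exact add_mem ha hb

section Generators

variable {n k : ℕ} {S : Submodule ℂ (FreeAlgebra ℂ (Fin n))}

lemma symm_triple_mem_of_mem_pow (hS : lcs n (k + 4) ≤ S) {N p q r : ℕ}
    (hN : degreeLeOne n ^ N ≤ lieTransporter (lcs n (k + 2)) S)
    (hpq : p + q ≤ N) (hpr : p + r ≤ N) (hqr : q + r ≤ N) {a b c : FreeAlgebra ℂ (Fin n)}
    (ha : a ∈ degreeLeOne n ^ p) (hb : b ∈ degreeLeOne n ^ q) (hc : c ∈ degreeLeOne n ^ r) :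
    a * b * c + a * c * b + b * a * c + b * c * a + c * a * b + c * b * a ∈
      lieTransporter (lcs n (k + 2)) S := by
  have mono := degreeLeOne_pow_mono n
  refine symm_triple_mem_lieTransporter hS (hN (mono (by omega) ha)) (hN (mono (by omega) hb))
    (hN (mono (by omega) hc)) (hN (add_mem ?_ ?_)) (hN (add_mem ?_ ?_)) (hN (add_mem ?_ ?_))
  · exact mul_mem_degreeLeOne_pow hpq ha hb
  · exact mul_mem_degreeLeOne_pow (by omega) hb ha
  · exact mul_mem_degreeLeOne_pow hpr ha hc
  · exact mul_mem_degreeLeOne_pow (by omega) hc ha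
  · exact mul_mem_degreeLeOne_pow hqr hb hc
  · exact mul_mem_degreeLeOne_pow (by omega) hc hb

lemma degreeLeOne_pow_succ_le (hS : lcs n (k + 4) ≤ S) {e : ℕ}
    (h : degreeLeOne n ^ (e + 3) ≤ lieTransporter (lcs n (k + 2)) S) :
    degreeLeOne n ^ (e + 4) ≤ lieTransporter (lcs n (k + 2)) S := by
  have hM := mul_lie_lie_mem_lieTransporter (n := n) hS
  rw [show e + 4 = (e + 1) + 1 + 1 + 1 by ring, pow_succ', Submodule.mul_le]
  intro x hx t ht
  rw [pow_succ'] at ht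
  refine mul_mem_of_mem_mul (fun y hy s hs => ?_) ht
  rw [pow_succ'] at hs
  rw [← mul_assoc]
  refine mul_mem_of_mem_mul (fun z hz c hc => ?_) hs
  rw [mul_assoc]
  rw [← pow_one (degreeLeOne n)] at hx hy hz
  have hyz := lie_mem_degreeLeOne_pow (N := 2) (by omega) hy hz
  have hyc := lie_mem_degreeLeOne_pow (N := e + 2) (by omega) hy hc
  have hzc := mul_mem_degreeLeOne_pow (N := e + 2) (by omega) hz hc
  refine mul_mul_mem_lieTransporter hS
    (symm_triple_mem_of_mem_pow hS h (by omega) (by omega) (by omega) hx hy hzc) ?_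
  have leib : x * ⁅y, z * c⁆ = x * (⁅y, z⁆ * c) + x * (z * ⁅y, c⁆) := by
    simp only [Ring.lie_def]; noncomm_ring
  rw [leib]
  refine add_mem (mul_mul_mem_lieTransporter hS
    (symm_triple_mem_of_mem_pow hS h (by omega) (by omega) (by omega) hx hyz hc) ?_)
    (mul_mul_mem_lieTransporter hS
    (symm_triple_mem_of_mem_pow hS h (by omega) (by omega) (by omega) hx hz hyc) (hM _ _ _ _))
  rw [← lie_skew, mul_neg]
  exact neg_mem (hM _ _ _ _)

lemma mul_lie_swap_left (hS : lcs n (k + 4) ≤ S) {x y z : FreeAlgebra ℂ (Fin n)}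
    (h : y * ⁅x, z⁆ ∈ lieTransporter (lcs n (k + 2)) S) :
    x * ⁅y, z⁆ ∈ lieTransporter (lcs n (k + 2)) S := by
  have e : x * ⁅y, z⁆ = ⁅x * y, z⁆ - ⁅⁅x, z⁆, y⁆ - y * ⁅x, z⁆ := by
    simp only [Ring.lie_def]; noncomm_ring
  rw [e]
  exact sub_mem (sub_mem (lie_mem_lieTransporter hS _ _) (lie_mem_lieTransporter hS _ _)) h

lemma mul_lie_swap_right {R : Submodule ℂ (FreeAlgebra ℂ (Fin n))}
    {x y z : FreeAlgebra ℂ (Fin n)} (h : x * ⁅z, y⁆ ∈ R) : x * ⁅y, z⁆ ∈ R := by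
  rw [← lie_skew, mul_neg]
  exact neg_mem h

lemma mul_lie_self_mem (hS : lcs n (k + 4) ≤ S) (x z : FreeAlgebra ℂ (Fin n)) :
    x * ⁅x, z⁆ ∈ lieTransporter (lcs n (k + 2)) S := by
  refine mem_of_zsmul_mem 2 two_ne_zero ?_
  have e : (2 : ℤ) • (x * ⁅x, z⁆) = ⁅x * x, z⁆ - ⁅⁅x, z⁆, x⁆ := by
    simp only [Ring.lie_def]; noncomm_ring
  rw [e]
  exact sub_mem (lie_mem_lieTransporter hS _ _) (lie_mem_lieTransporter hS _ _)

lemma ι_mul_lie_mem (hS : lcs n (k + 4) ≤ S)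
    (h : ∀ i j l : Fin n, i < j → j < l →
      FreeAlgebra.ι ℂ i * ⁅FreeAlgebra.ι ℂ j, FreeAlgebra.ι ℂ l⁆ ∈
        lieTransporter (lcs n (k + 2)) S) (i j l : Fin n) :
    FreeAlgebra.ι ℂ i * ⁅FreeAlgebra.ι ℂ j, FreeAlgebra.ι ℂ l⁆ ∈
      lieTransporter (lcs n (k + 2)) S := by
  have aux : ∀ i j l : Fin n, j < l →
      FreeAlgebra.ι ℂ i * ⁅FreeAlgebra.ι ℂ j, FreeAlgebra.ι ℂ l⁆ ∈
        lieTransporter (lcs n (k + 2)) S := by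
    intro i j l hjl
    rcases lt_trichotomy i j with hij | rfl | hij
    · exact h i j l hij hjl
    · exact mul_lie_self_mem hS _ _
    · refine mul_lie_swap_left hS ?_
      rcases lt_trichotomy i l with hil | rfl | hil
      · exact h j i l hij hil
      · simp
      · exact mul_lie_swap_right (h j l i hjl hil)
  rcases lt_trichotomy j l with hjl | rfl | hjl
  · exact aux i j l hjl
  · simp
  · exact mul_lie_swap_right (aux i l j hjl)

lemma lieTransporter_eq_top (hS : lcs n (k + 4) ≤ S)
    (h₁ : ∀ i : Fin n, FreeAlgebra.ι ℂ i ∈ lieTransporter (lcs n (k + 2)) S)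
    (h₂ : ∀ i j : Fin n, i ≤ j →
      FreeAlgebra.ι ℂ i * FreeAlgebra.ι ℂ j ∈ lieTransporter (lcs n (k + 2)) S)
    (h₃ : ∀ i j l : Fin n, i < j → j < l →
      FreeAlgebra.ι ℂ i * ⁅FreeAlgebra.ι ℂ j, FreeAlgebra.ι ℂ l⁆ ∈
        lieTransporter (lcs n (k + 2)) S) :
    lieTransporter (lcs n (k + 2)) S = ⊤ := by
  have one_mem : (1 : FreeAlgebra ℂ (Fin n)) ∈ lieTransporter (lcs n (k + 2)) S := by
    intro w _
    simp [Ring.lie_def]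
  have deg₂ : degreeLeOne n ^ 2 ≤ lieTransporter (lcs n (k + 2)) S := by
    rw [pow_two, degreeLeOne, Submodule.span_mul_span, Submodule.span_le]
    rintro _ ⟨a, rfl | ⟨i, rfl⟩, b, rfl | ⟨j, rfl⟩, rfl⟩
    · simpa using one_mem
    · simpa using h₁ j
    · simpa using h₁ i
    · rcases le_total i j with hij | hij
      · exact h₂ i j hij
      · have := add_mem (h₂ j i hij)
          (lie_mem_lieTransporter hS (FreeAlgebra.ι ℂ i) (FreeAlgebra.ι ℂ j))
        rwa [Ring.lie_def, add_sub_cancel] at this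
  have mul_lie : ∀ x ∈ degreeLeOne n, ∀ y ∈ degreeLeOne n, ∀ z ∈ degreeLeOne n,
      x * ⁅y, z⁆ ∈ lieTransporter (lcs n (k + 2)) S := by
    intro x hx y hy z hz
    induction hx using Submodule.span_induction with
    | zero => simp
    | add _ _ _ _ hx hy => rw [add_mul]; exact add_mem hx hy
    | smul c _ _ hx => rw [smul_mul_assoc]; exact Submodule.smul_mem _ c hx
    | mem x hx =>
    induction hy using Submodule.span_induction with
    | zero => simp
    | add _ _ _ _ hx hy => rw [add_lie, mul_add]; exact add_mem hx hy
    | smul c _ _ hx => rw [smul_lie, mul_smul_comm]; exact Submodule.smul_mem _ c hx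
    | mem y hy =>
    induction hz using Submodule.span_induction with
    | zero => simp
    | add _ _ _ _ hx hy => rw [lie_add, mul_add]; exact add_mem hx hy
    | smul c _ _ hx => rw [lie_smul, mul_smul_comm]; exact Submodule.smul_mem _ c hx
    | mem z hz =>
    rcases hx with rfl | ⟨i, rfl⟩
    · rw [one_mul]
      exact lie_mem_lieTransporter hS _ _
    rcases hy with rfl | ⟨j, rfl⟩
    · simp [Ring.lie_def]
    rcases hz with rfl | ⟨l, rfl⟩
    · simp [Ring.lie_def]
    exact ι_mul_lie_mem hS h₃ i j l
  have deg₃ : degreeLeOne n ^ 3 ≤ lieTransporter (lcs n (k + 2)) S := by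
    rw [pow_succ', Submodule.mul_le]
    intro x hx t ht
    rw [pow_two] at ht
    refine mul_mem_of_mem_mul (fun y hy z hz => ?_) ht
    refine mul_mul_mem_lieTransporter hS ?_ (mul_lie x hx y hy z hz)
    rw [← pow_one (degreeLeOne n)] at hx hy hz
    exact symm_triple_mem_of_mem_pow hS deg₂ le_rfl le_rfl le_rfl hx hy hz
  have deg : ∀ e, degreeLeOne n ^ (e + 3) ≤ lieTransporter (lcs n (k + 2)) S := by
    intro e
    induction e with
    | zero => exact deg₃
    | succ e ih => exact degreeLeOne_pow_succ_le hS ih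
  refine eq_top_iff.mpr fun a _ => ?_
  obtain ⟨d, hd⟩ := exists_mem_degreeLeOne_pow a
  exact deg d (degreeLeOne_pow_mono n (Nat.le_add_right d 3) hd)

end Generators

lemma brS_le_lcs {n k : ℕ} (g : FreeAlgebra ℂ (Fin n)) :
    brS g (lcs n (k + 1)) ≤ lcs n (k + 2) := by
  rw [brS, Submodule.span_le]
  rintro _ ⟨w, hw, rfl⟩
  exact lie_mem_lcs g hw

lemma mem_lieTransporter_of_brS_le {n : ℕ} {g : FreeAlgebra ℂ (Fin n)}
    {V S : Submodule ℂ (FreeAlgebra ℂ (Fin n))} (h : brS g V ≤ S) : g ∈ lieTransporter V S :=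
  fun w hw => h (Submodule.subset_span ⟨w, hw, rfl⟩)

lemma le_sum_submodule {n : ℕ} {ι : Type*} (s : Finset ι)
    (f : ι → Submodule ℂ (FreeAlgebra ℂ (Fin n))) {i : ι} (hi : i ∈ s) : f i ≤ ∑ j ∈ s, f j :=
  Finset.single_le_sum_of_canonicallyOrdered hi

lemma sum_submodule_le {n : ℕ} {ι : Type*} (s : Finset ι)
    (f : ι → Submodule ℂ (FreeAlgebra ℂ (Fin n))) {S : Submodule ℂ (FreeAlgebra ℂ (Fin n))}
    (h : ∀ i ∈ s, f i ≤ S) : ∑ j ∈ s, f j ≤ S :=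
  Finset.sum_induction f (· ≤ S) (fun _ _ ha hb => sup_le ha hb) bot_le h

/-- for `n ≥ 4` and `m ≥ 2`,
`L_{m+1} = Σ_i [x_i, L_m] + Σ_{i ≤ j} [x_i x_j, L_m] + Σ_{i<j<k} [x_i[x_j,x_k], L_m] + L_{m+2}`. -/
theorem stmt_1 (n : ℕ) (hn : 4 ≤ n) (m : ℕ) (hm : 2 ≤ m) :
    lcs n (m + 1) =
      (∑ i : Fin n, brS (FreeAlgebra.ι ℂ i) (lcs n m))
      + (∑ p ∈ Finset.univ.filter (fun p : Fin n × Fin n => p.1 ≤ p.2),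
          brS (FreeAlgebra.ι ℂ p.1 * FreeAlgebra.ι ℂ p.2) (lcs n m))
      + (∑ p ∈ Finset.univ.filter
            (fun p : Fin n × Fin n × Fin n => p.1 < p.2.1 ∧ p.2.1 < p.2.2),
          brS (FreeAlgebra.ι ℂ p.1 *
              (FreeAlgebra.ι ℂ p.2.1 * FreeAlgebra.ι ℂ p.2.2
                - FreeAlgebra.ι ℂ p.2.2 * FreeAlgebra.ι ℂ p.2.1)) (lcs n m))
      + lcs n (m + 2) := by
  obtain ⟨k, rfl⟩ := Nat.exists_eq_add_of_le' hm
  apply le_antisymm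
  · rw [lcs_add_two, Submodule.span_le]
    rintro _ ⟨a, w, hw, rfl⟩
    refine (?_ : a ∈ lieTransporter (lcs n (k + 2)) _) w hw
    rw [lieTransporter_eq_top]
    · trivial
    · exact le_sup_right
    · exact fun i => mem_lieTransporter_of_brS_le <|
        (le_sum_submodule Finset.univ (fun i => brS (FreeAlgebra.ι ℂ i) (lcs n (k + 2)))
          (Finset.mem_univ i)).trans ((le_sup_left.trans le_sup_left).trans le_sup_left)
    · exact fun i j hij => mem_lieTransporter_of_brS_le <|
        (le_sum_submodule (Finset.univ.filter (fun p : Fin n × Fin n => p.1 ≤ p.2))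
          (fun p => brS (FreeAlgebra.ι ℂ p.1 * FreeAlgebra.ι ℂ p.2) (lcs n (k + 2)))
          (i := (i, j)) (by simpa using hij)).trans
          ((le_sup_right.trans le_sup_left).trans le_sup_left)
    · exact fun i j l hij hjl => mem_lieTransporter_of_brS_le <|
        (le_sum_submodule (Finset.univ.filter
            (fun p : Fin n × Fin n × Fin n => p.1 < p.2.1 ∧ p.2.1 < p.2.2))
          (fun p => brS (FreeAlgebra.ι ℂ p.1 *
              (FreeAlgebra.ι ℂ p.2.1 * FreeAlgebra.ι ℂ p.2.2
                - FreeAlgebra.ι ℂ p.2.2 * FreeAlgebra.ι ℂ p.2.1)) (lcs n (k + 2)))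
          (i := (i, j, l)) (by simpa using ⟨hij, hjl⟩)).trans (le_sup_right.trans le_sup_left)
  · exact sup_le (sup_le (sup_le (sum_submodule_le _ _ fun _ _ => brS_le_lcs _)
      (sum_submodule_le _ _ fun _ _ => brS_le_lcs _))
      (sum_submodule_le _ _ fun _ _ => brS_le_lcs _)) (lcs_succ_le n (k + 2))
end

section
/- The third term of the lower central series of the free algebra is generated over L_2 by brackets with linear and quadratic monomials: L_3 = Σ_{i} [x_i, L_2] + Σ_{i ≤ j} [x_i x_j, L_2] + L_4; i.e. B_3 = Σ_i [x_i, B_2] + Σ_{i≤j} [x_i x_j, B_2]. -/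
section RingIdentities

variable {R : Type*} [Ring R]

theorem three_nsmul_lie_mul_triple_lie (f g h u v : R) :
    3 • ⁅f * ⁅g, ⁅h, u⁆⁆, v⁆ =
      ⁅u * v, ⁅h, ⁅f, g⁆⁆⁆ + ⁅v, ⁅h * g, ⁅f, u⁆⁆⁆ + ⁅g, ⁅f, ⁅h, u * v⁆⁆⁆
      + ⁅g, ⁅v * u, ⁅f, h⁆⁆⁆ + ⁅u, ⁅g * h, ⁅f, v⁆⁆⁆ + ⁅u, ⁅g, ⁅f * v, h⁆⁆⁆
      + ⁅f, ⁅g * v, ⁅h, u⁆⁆⁆ + ⁅f, ⁅v, ⁅h, u * g⁆⁆⁆ + ⁅f, ⁅u, ⁅h * g, v⁆⁆⁆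
      + ⁅u * f, ⁅h, ⁅g, v⁆⁆⁆
      - ⁅v, ⁅f * h, ⁅g, u⁆⁆⁆ - ⁅v, ⁅h, ⁅f, g * u⁆⁆⁆ - ⁅g, ⁅u, ⁅f * v, h⁆⁆⁆
      - ⁅v * f, ⁅g, ⁅h, u⁆⁆⁆ - ⁅v * f, ⁅g, ⁅h, u⁆⁆⁆ - ⁅u, ⁅g, ⁅f, h * v⁆⁆⁆
      - ⁅g * u, ⁅h, ⁅f, v⁆⁆⁆ - ⁅f * g, ⁅v, ⁅h, u⁆⁆⁆ - ⁅f, ⁅g * u, ⁅h, v⁆⁆⁆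
      - ⁅v * h, ⁅u, ⁅f, g⁆⁆⁆ - ⁅f, ⁅v, ⁅g * h, u⁆⁆⁆ - ⁅f * h, ⁅g, ⁅u, v⁆⁆⁆ := by
  simp only [Ring.lie_def]
  noncomm_ring

theorem lie_mul_mul_lie (f g h u v : R) :
    ⁅f * g * h, ⁅u, v⁆⁆ =
      ⁅g * h, ⁅u, v * f⁆⁆ + ⁅g, ⁅h * v * f, u⁆⁆ + ⁅h, ⁅v, ⁅f, u * g⁆⁆⁆
      + ⁅f, ⁅g * v * h, u⁆⁆ + ⁅h, ⁅g * f * v, u⁆⁆ - ⁅f * g, ⁅h * v, u⁆⁆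
      - ⁅h, ⁅v * u, ⁅f, g⁆⁆⁆ - ⁅h * f, ⁅g * v, u⁆⁆ + ⁅g * ⁅v, ⁅h, u⁆⁆, f⁆ := by
  simp only [Ring.lie_def]
  noncomm_ring

end RingIdentities

section CommutatorTransporter

variable {K A : Type*} [Field K] [Ring A] [Algebra K A] {N : Submodule K A}

/-- If `N` contains `L_4`, the span of the triple commutators, then it contains `[A L_3, A]`. -/
theorem lie_mul_triple_lie_mem [NeZero (3 : K)]
    (hN : ∀ a b c d : A, ⁅a, ⁅b, ⁅c, d⁆⁆⁆ ∈ N) (f g h u v : A) :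
    ⁅f * ⁅g, ⁅h, u⁆⁆, v⁆ ∈ N := by
  have key : (3 : K) • ⁅f * ⁅g, ⁅h, u⁆⁆, v⁆ ∈ N := by
    rw [ofNat_smul_eq_nsmul K 3, three_nsmul_lie_mul_triple_lie]
    repeat' first
      | exact hN _ _ _ _
      | apply Submodule.sub_mem
      | apply Submodule.add_mem
  exact (Submodule.smul_mem_iff _ three_ne_zero).1 key

/-- The elements `a` with `[a, [A, A]] ⊆ N`. -/
def commutatorTransporter (N : Submodule K A) : Submodule K A where
  carrier := {a | ∀ u v : A, ⁅a, ⁅u, v⁆⁆ ∈ N}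
  add_mem' ha hb u v := by
    simpa only [Ring.lie_def, add_mul, mul_add, add_sub_add_comm] using N.add_mem (ha u v) (hb u v)
  zero_mem' u v := by
    simpa only [Ring.lie_def, zero_mul, mul_zero, sub_zero] using N.zero_mem
  smul_mem' c a ha u v := by
    simpa only [Ring.lie_def, smul_mul_assoc, mul_smul_comm, smul_sub] using N.smul_mem c (ha u v)

namespace commutatorTransporter

theorem lie_lie_mem {a : A} (ha : a ∈ commutatorTransporter N) (u v : A) : ⁅a, ⁅u, v⁆⁆ ∈ N :=
  ha u v

theorem one_mem : 1 ∈ commutatorTransporter N := fun u v => by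
  rw [Ring.lie_def, one_mul, mul_one, sub_self]
  exact N.zero_mem

theorem mul_mul_mem [NeZero (3 : K)] (hN : ∀ a b c d : A, ⁅a, ⁅b, ⁅c, d⁆⁆⁆ ∈ N) {f g h : A}
    (hf : f ∈ commutatorTransporter N) (hg : g ∈ commutatorTransporter N)
    (hh : h ∈ commutatorTransporter N) (hfg : f * g ∈ commutatorTransporter N)
    (hgh : g * h ∈ commutatorTransporter N) (hhf : h * f ∈ commutatorTransporter N) :
    f * g * h ∈ commutatorTransporter N := fun u v => by
  rw [lie_mul_mul_lie]
  repeat' first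
    | exact lie_lie_mem (by assumption) _ _
    | exact lie_mul_triple_lie_mem hN _ _ _ _ _
    | apply Submodule.sub_mem
    | apply Submodule.add_mem

theorem lie_mem (hN : ∀ a b c d : A, ⁅a, ⁅b, ⁅c, d⁆⁆⁆ ∈ N) (a b : A) :
    ⁅a, b⁆ ∈ commutatorTransporter N := fun u v => by
  have jacobi : ⁅⁅a, b⁆, ⁅u, v⁆⁆ = ⁅a, ⁅b, ⁅u, v⁆⁆⁆ - ⁅b, ⁅a, ⁅u, v⁆⁆⁆ := by
    simp only [Ring.lie_def]
    noncomm_ring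
  rw [jacobi]
  exact sub_mem (hN a b u v) (hN b a u v)

theorem mul_mem_comm (hN : ∀ a b c d : A, ⁅a, ⁅b, ⁅c, d⁆⁆⁆ ∈ N) {a b : A}
    (h : a * b ∈ commutatorTransporter N) : b * a ∈ commutatorTransporter N := by
  have := sub_mem h (lie_mem hN a b)
  rwa [Ring.lie_def, sub_sub_cancel] at this

theorem list_prod_mem [NeZero (3 : K)] (hN : ∀ a b c d : A, ⁅a, ⁅b, ⁅c, d⁆⁆⁆ ∈ N)
    {ι : Type*} {x : ι → A} (h1 : ∀ i, x i ∈ commutatorTransporter N)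
    (h2 : ∀ i j, x i * x j ∈ commutatorTransporter N) :
    ∀ l : List ι, (l.map x).prod ∈ commutatorTransporter N
  | [] => one_mem
  | [i] => by simpa using h1 i
  | i :: j :: l => by
    have hl := list_prod_mem hN h1 h2 l
    have hi := list_prod_mem hN h1 h2 (i :: l)
    have hj := list_prod_mem hN h1 h2 (j :: l)
    simp only [List.map_cons, List.prod_cons] at hi hj ⊢
    rw [← mul_assoc]
    exact mul_mul_mem hN (h1 i) (h1 j) hl (h2 i j) hj (mul_mem_comm hN hi)
  termination_by l => l.length

theorem eq_top [NeZero (3 : K)] (hN : ∀ a b c d : A, ⁅a, ⁅b, ⁅c, d⁆⁆⁆ ∈ N)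
    {ι : Type*} {x : ι → A} (hx : Algebra.adjoin K (Set.range x) = ⊤)
    (h1 : ∀ i, x i ∈ commutatorTransporter N)
    (h2 : ∀ i j, x i * x j ∈ commutatorTransporter N) :
    commutatorTransporter N = ⊤ := by
  rw [eq_top_iff, ← Algebra.top_toSubmodule, ← hx, Algebra.adjoin_eq_span, Submodule.span_le]
  intro y hy
  obtain ⟨l, hl, rfl⟩ := Submonoid.exists_list_of_mem_closure hy
  obtain ⟨l, rfl⟩ : l ∈ Set.range (List.map x) := by rwa [Set.range_list_map]
  exact list_prod_mem hN h1 h2 l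

end commutatorTransporter

end CommutatorTransporter

namespace lcs

variable {n : ℕ} {N : Submodule ℂ (FreeAlgebra ℂ (Fin n))}

theorem lie_mem {m : ℕ} {w : FreeAlgebra ℂ (Fin n)} (a : FreeAlgebra ℂ (Fin n))
    (hw : w ∈ lcs n (m + 1)) : ⁅a, w⁆ ∈ lcs n (m + 2) :=
  Submodule.subset_span ⟨a, w, hw, Ring.lie_def a w⟩

theorem lie_mem_two (a b : FreeAlgebra ℂ (Fin n)) : ⁅a, b⁆ ∈ lcs n 2 :=
  lie_mem (m := 0) a Submodule.mem_top

theorem triple_lie_mem (a b c d : FreeAlgebra ℂ (Fin n)) : ⁅a, ⁅b, ⁅c, d⁆⁆⁆ ∈ lcs n 4 :=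
  lie_mem a (lie_mem b (lie_mem_two c d))

theorem succ_le (m : ℕ) : lcs n (m + 2) ≤ lcs n (m + 1) := by
  induction m with
  | zero => exact le_top
  | succ k ih =>
    refine Submodule.span_mono ?_
    rintro _ ⟨a, w, hw, rfl⟩
    exact ⟨a, w, ih hw, rfl⟩

theorem brS_le_three (g : FreeAlgebra ℂ (Fin n)) : brS g (lcs n 2) ≤ lcs n 3 :=
  Submodule.span_mono fun _ ⟨w, hw, hy⟩ => ⟨g, w, hw, hy⟩

theorem mem_commutatorTransporter_of_brS_le {g : FreeAlgebra ℂ (Fin n)}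
    (h : brS g (lcs n 2) ≤ N) : g ∈ commutatorTransporter N :=
  fun u v => h (Submodule.subset_span ⟨⁅u, v⁆, lie_mem_two u v, Ring.lie_def _ _⟩)

theorem three_le_of_commutatorTransporter_eq_top (h : commutatorTransporter N = ⊤) :
    lcs n 3 ≤ N := by
  refine Submodule.span_le.2 ?_
  rintro _ ⟨a, w, hw, rfl⟩
  have ha : a ∈ commutatorTransporter N := h ▸ Submodule.mem_top
  have hle : lcs n 2 ≤ N.comap (LinearMap.mulLeft ℂ a - LinearMap.mulRight ℂ a) := by
    refine Submodule.span_le.2 ?_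
    rintro _ ⟨u, v, -, rfl⟩
    exact ha u v
  exact hle hw

end lcs

/-- `L_3 = Σ_i [x_i, L_2] + Σ_{i ≤ j} [x_i x_j, L_2] + L_4`. -/
theorem stmt_11 (n : ℕ) (hn : 2 ≤ n) :
    lcs n 3 =
      (∑ i : Fin n, brS (FreeAlgebra.ι ℂ i) (lcs n 2))
      + (∑ p ∈ Finset.univ.filter (fun p : Fin n × Fin n => p.1 ≤ p.2),
          brS (FreeAlgebra.ι ℂ p.1 * FreeAlgebra.ι ℂ p.2) (lcs n 2))
      + lcs n 4 := by
  refine le_antisymm ?_ ?_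
  · set N := (∑ i : Fin n, brS (FreeAlgebra.ι ℂ i) (lcs n 2))
      + (∑ p ∈ Finset.univ.filter (fun p : Fin n × Fin n => p.1 ≤ p.2),
          brS (FreeAlgebra.ι ℂ p.1 * FreeAlgebra.ι ℂ p.2) (lcs n 2))
      + lcs n 4
    have hN (a b c d : FreeAlgebra ℂ (Fin n)) : ⁅a, ⁅b, ⁅c, d⁆⁆⁆ ∈ N :=
      (le_sup_right : lcs n 4 ≤ N) (lcs.triple_lie_mem a b c d)
    have h1 (i : Fin n) : FreeAlgebra.ι ℂ i ∈ commutatorTransporter N :=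
      lcs.mem_commutatorTransporter_of_brS_le <|
        (Finset.single_le_sum_of_canonicallyOrdered
          (f := fun i : Fin n => brS (FreeAlgebra.ι ℂ i) (lcs n 2)) (Finset.mem_univ i)).trans
          (le_sup_left.trans le_sup_left)
    have h2_of_le (i j : Fin n) (hij : i ≤ j) :
        FreeAlgebra.ι ℂ i * FreeAlgebra.ι ℂ j ∈ commutatorTransporter N :=
      lcs.mem_commutatorTransporter_of_brS_le <|
        (Finset.single_le_sum_of_canonicallyOrdered
          (f := fun p : Fin n × Fin n =>
            brS (FreeAlgebra.ι ℂ p.1 * FreeAlgebra.ι ℂ p.2) (lcs n 2))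
          (Finset.mem_filter.2 ⟨Finset.mem_univ (i, j), hij⟩)).trans
          (le_sup_right.trans le_sup_left)
    have h2 (i j : Fin n) : FreeAlgebra.ι ℂ i * FreeAlgebra.ι ℂ j ∈ commutatorTransporter N :=
      (le_total i j).elim (h2_of_le i j)
        fun hji => commutatorTransporter.mul_mem_comm hN (h2_of_le j i hji)
    exact lcs.three_le_of_commutatorTransporter_eq_top <|
      commutatorTransporter.eq_top hN (FreeAlgebra.adjoin_range_ι ℂ (Fin n)) h1 h2
  · refine sup_le (sup_le ?_ ?_) (lcs.succ_le 2)
    · exact Finset.sum_induction _ (· ≤ lcs n 3) (fun _ _ => sup_le) bot_le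
        fun i _ => lcs.brS_le_three _
    · exact Finset.sum_induction _ (· ≤ lcs n 3) (fun _ _ => sup_le) bot_le
        fun p _ => lcs.brS_le_three _
end
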